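/- Let k be a field of characteristic different from 2, let b be a unit of k((u)), and set a = b̄ · b^{-1}, where f̄ denotes the Laurent series obtained from f by multiplying its n-th coefficient by (−1)^n. If all coefficients of a in negative degrees vanish (i.e., a ∈ k[[u]]), then the constant coefficient of a equals (−1)^{ord(b)}, where ord(b) is the order of b; in particular the constant coefficient of a is ±1. (This expresses that a ≡ κ_T(a) mod (u) for the Kottwitz invariant κ_T of the norm-one torus.) -/

import Mathlib

/-- The coefficientwise involution of `k((u))` induced by `u ↦ -u`:
it sends `Σ aₙ uⁿ` to `Σ (-1)ⁿ aₙ uⁿ`. -/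
def LaurentSeries.uBar {k : Type*} [CommRing k] (f : LaurentSeries k) :
    LaurentSeries k where
  coeff n := (((-1 : kˣ) ^ n : kˣ) : k) * f.coeff n
  isPWO_support' := f.isPWO_support'.mono (by
    intro n hn
    simp only [Function.mem_support] at hn ⊢
    intro h
    exact hn (by rw [h, mul_zero]))

namespace LaurentSeries

variable {k : Type*} [CommRing k]

theorem coeff_uBar (f : LaurentSeries k) (n : ℤ) :
    (uBar f).coeff n = (((-1 : kˣ) ^ n : kˣ) : k) * f.coeff n :=
  rfl

theorem coeff_uBar_eq_zero_iff (f : LaurentSeries k) (n : ℤ) :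
    (uBar f).coeff n = 0 ↔ f.coeff n = 0 := by
  rw [coeff_uBar, Units.mul_right_eq_zero]

theorem uBar_ne_zero {f : LaurentSeries k} (hf : f ≠ 0) : uBar f ≠ 0 := fun h =>
  HahnSeries.coeff_order_eq_zero.not.mpr hf <| by
    rw [← coeff_uBar_eq_zero_iff, h, HahnSeries.coeff_zero]

theorem order_uBar {f : LaurentSeries k} (hf : f ≠ 0) : (uBar f).order = f.order := by
  apply le_antisymm
  · apply HahnSeries.order_le_of_coeff_ne_zero
    rw [Ne, coeff_uBar_eq_zero_iff]
    exact HahnSeries.coeff_order_eq_zero.not.mpr hf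
  · apply HahnSeries.order_le_of_coeff_ne_zero
    rw [Ne, ← coeff_uBar_eq_zero_iff]
    exact HahnSeries.coeff_order_eq_zero.not.mpr (uBar_ne_zero hf)

end LaurentSeries

/-- Let `k` be a field of characteristic `≠ 2`, `b` a unit of
`k((u))` and `a = b̄ · b⁻¹`.  If all coefficients of `a` in negative degrees
vanish (i.e. `a ∈ k[[u]]`), then the constant coefficient of `a` equals
`(-1)^{ord(b)}`; in particular it is `±1`. -/
theorem stmt7 (k : Type*) [Field k] (hchar : (2 : k) ≠ 0)
    (b : (LaurentSeries k)ˣ) (a : LaurentSeries k)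
    (ha : a = LaurentSeries.uBar (b : LaurentSeries k) *
            ((b⁻¹ : (LaurentSeries k)ˣ) : LaurentSeries k))
    (hint : ∀ n : ℤ, n < 0 → a.coeff n = 0) :
    a.coeff 0 = (-1 : k) ^ ((b : LaurentSeries k).order) := by
  have hb : (b : LaurentSeries k) ≠ 0 := b.ne_zero
  have hab : a * b = LaurentSeries.uBar (b : LaurentSeries k) := by
    rw [ha, mul_assoc, Units.inv_mul, mul_one]
  have ha0 : a ≠ 0 := by
    rintro rfl
    exact LaurentSeries.uBar_ne_zero hb (by rw [← hab, zero_mul])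
  have hord : a.order = 0 := by
    have h := HahnSeries.order_mul ha0 hb
    rw [hab, LaurentSeries.order_uBar hb] at h
    lia
  have hc := HahnSeries.coeff_mul_order_add_order a (b : LaurentSeries k)
  rw [hab, hord, zero_add, LaurentSeries.coeff_uBar, HahnSeries.leadingCoeff_eq,
    HahnSeries.leadingCoeff_eq, hord] at hc
  rw [← mul_right_cancel₀ (HahnSeries.coeff_order_eq_zero.not.mpr hb) hc]
  simp
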